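/- Let ρ > 0, μ > 0, let B = Π_{i=1}^3 [a_i, b_i] ⊂ ℝ³ be a closed rectangular box, and fix x₀ ∈ ℝ³ and a time t. Let φ : ℝ³ → ℝ be integrable with ∫ φ = 1, with x ↦ x φ(x) integrable and ∫ x φ(x) dx = 0; let U ⊆ ℝ³ be measurable, F : U → ℝ³ integrable with s ↦ ‖X(s)‖ ‖F(s)‖ integrable, X : U → ℝ³ measurable, and suppose f(x) = ∫_U F(s) φ(x − X(s)) ds vanishes for all x outside B. Suppose on a neighborhood of B the velocity u(·,t) is twice continuously differentiable in space and differentiable in time with ∇·u = 0, p(·,t) is continuously differentiable, f is continuous, and ρ(∂u/∂t + (u·∇)u) = −∇p + μ Δu + f holds on B. Write r(x) = x − x₀ and T = μ(∇u + ∇uᵀ). Then the total Lagrangian torque equals the control-volume expression: ∫_U (X(s) − x₀) × F(s) ds = ∫_B ρ r × ∂u/∂t dV − ∮_{∂B} [ r × (n·(−pI + T)) − (n·u) ρ (r × u) ] dS, with the boundary term given by the face-wise sum over the six faces of B with the corresponding outward normals n = ±e_i. -/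

import Mathlib

open MeasureTheory

/-- The partial derivative `∂_j g (x)` of a field on `ℝ^m`. -/
noncomputable def pd {m : ℕ} {E : Type*} [NormedAddCommGroup E] [NormedSpace ℝ E]
    (g : (Fin m → ℝ) → E) (j : Fin m) (x : Fin m → ℝ) : E :=
  fderiv ℝ g x (Pi.single j 1)

/-- The integral of `g` over the face `x_i = c` of the box `Π_i [a_i, b_i] ⊆ ℝ^{m+1}`,
parametrized by the remaining `m` coordinates. -/
noncomputable def faceInt {m : ℕ} {E : Type*} [NormedAddCommGroup E] [NormedSpace ℝ E]
    (a b : Fin (m + 1) → ℝ) (g : (Fin (m + 1) → ℝ) → E) (i : Fin (m + 1)) (c : ℝ) : E :=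
  ∫ y in Set.Icc (a ∘ i.succAbove) (b ∘ i.succAbove), g (i.insertNth c y)

/-- The Cauchy stress `σ = −p I + μ(∇u + ∇uᵀ)`, entry `(k, i)`. -/
noncomputable def sigmaCauchy {m : ℕ} (μ : ℝ)
    (p : (Fin m → ℝ) → ℝ) (u : (Fin m → ℝ) → Fin m → ℝ)
    (x : Fin m → ℝ) (k i : Fin m) : ℝ :=
  -(p x) * (if k = i then 1 else 0) + μ * (pd u i x k + pd u k x i)

/-- The first-moment identity for a density spread by a kernel of unit integral and vanishing first
moment, for an arbitrary continuous bilinear pairing. -/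
theorem integral_bilin_spread {S E G H : Type*} [MeasurableSpace S]
    [NormedAddCommGroup E] [NormedSpace ℝ E] [CompleteSpace E]
    [MeasurableSpace E] [BorelSpace E] [SecondCountableTopology E]
    [NormedAddCommGroup G] [NormedSpace ℝ G] [CompleteSpace G]
    [NormedAddCommGroup H] [NormedSpace ℝ H] [CompleteSpace H]
    (ν : Measure S) [SFinite ν] (vol : Measure E) [SFinite vol] [vol.IsAddRightInvariant]
    (L : E →L[ℝ] G →L[ℝ] H) (x₀ : E)
    {φ : E → ℝ} (hφ : Integrable φ vol) (hφ1 : ∫ x, φ x ∂vol = 1)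
    (hφm : Integrable (fun x => φ x • x) vol) (hφm0 : ∫ x, φ x • x ∂vol = 0)
    {F : S → G} {X : S → E} (hF : Integrable F ν) (hX : Measurable X)
    (hXF : Integrable (fun s => ‖X s‖ * ‖F s‖) ν) :
    ∫ x, L (x - x₀) (∫ s, φ (x - X s) • F s ∂ν) ∂vol = ∫ s, L (X s - x₀) (F s) ∂ν := by
  have hshear : MeasurePreserving (fun z : S × E => (z.1, z.2 - X z.1))
      (ν.prod vol) (ν.prod vol) := by
    refine (MeasurePreserving.id ν).skew_product (g := fun s x => x - X s)
      (measurable_snd.sub (hX.comp measurable_fst)) (.of_forall fun s => ?_)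
    simpa only [sub_eq_add_neg] using map_add_right_eq_self vol (-X s)
  have hLXF : Integrable (fun s => L (X s - x₀) (F s)) ν := by
    refine (((hXF.add (hF.norm.const_mul ‖x₀‖)).const_mul ‖L‖)).mono'
      (L.aestronglyMeasurable_comp₂ (hX.sub_const x₀).aestronglyMeasurable
        hF.aestronglyMeasurable) (.of_forall fun s => ?_)
    calc ‖L (X s - x₀) (F s)‖ ≤ ‖L‖ * ‖X s - x₀‖ * ‖F s‖ := L.le_opNorm₂ _ _
      _ ≤ ‖L‖ * (‖X s‖ + ‖x₀‖) * ‖F s‖ := by gcongr; exact norm_sub_le _ _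
      _ = ‖L‖ * (‖X s‖ * ‖F s‖ + ‖x₀‖ * ‖F s‖) := by ring
  have hspread : Integrable (fun z : S × E => φ (z.2 - X z.1) • F z.1) (ν.prod vol) :=
    hshear.integrable_comp_of_integrable (g := fun z : S × E => φ z.2 • F z.1)
      (hφ.smul_prod hF).swap
  have hfst : Integrable (fun z : S × E => L (φ z.2 • z.2) (F z.1)) (ν.prod vol) :=
    (hφm.op_fst_snd (op := fun x y => L x y) (by fun_prop) ⟨‖L‖, L.le_opNorm₂⟩ hF).swap
  have hsnd : Integrable (fun z : S × E => φ z.2 • L (X z.1 - x₀) (F z.1)) (ν.prod vol) :=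
    (hφ.smul_prod hLXF).swap
  have hpair : Integrable (fun z : S × E => φ (z.2 - X z.1) • L (z.2 - x₀) (F z.1))
      (ν.prod vol) := by
    have h := hshear.integrable_comp_of_integrable (hfst.add hsnd)
    refine h.congr (.of_forall fun z => ?_)
    simp only [Function.comp, Pi.add_apply, map_smul, smul_apply, ← smul_add,
      ← add_apply, ← map_add]
    congr 3
    abel
  calc ∫ x, L (x - x₀) (∫ s, φ (x - X s) • F s ∂ν) ∂vol
      = ∫ x, ∫ s, φ (x - X s) • L (x - x₀) (F s) ∂ν ∂vol := by
        refine integral_congr_ae ?_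
        filter_upwards [hspread.prod_left_ae] with x hx
        rw [← ContinuousLinearMap.integral_comp_comm _ hx]
        simp only [map_smul]
    _ = ∫ s, ∫ x, φ (x - X s) • L (x - x₀) (F s) ∂vol ∂ν :=
        (integral_integral_swap (f := fun s x => φ (x - X s) • L (x - x₀) (F s)) hpair).symm
    _ = ∫ s, L (X s - x₀) (F s) ∂ν := by
        refine integral_congr_ae ?_
        filter_upwards [hfst.prod_right_ae, hsnd.prod_right_ae] with s h₁ h₂
        rw [← integral_add_right_eq_self _ (X s)]
        have hsplit : ∀ x, φ (x + X s - X s) • L (x + X s - x₀) (F s)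
            = L.flip (F s) (φ x • x) + φ x • L (X s - x₀) (F s) := fun x => by
          rw [add_sub_cancel_right, add_sub_assoc, map_add, add_apply,
            smul_add, map_smul, ContinuousLinearMap.flip_apply]
        simp only [hsplit]
        rw [integral_add (f := fun x => L.flip (F s) (φ x • x)) h₁ h₂,
          ContinuousLinearMap.integral_comp_comm _ hφm, hφm0, map_zero, integral_smul_const, hφ1, one_smul, zero_add]

theorem pd_apply {m n : ℕ} {g : (Fin m → ℝ) → Fin n → ℝ} {x : Fin m → ℝ}
    (hg : DifferentiableAt ℝ g x) (j : Fin m) (k : Fin n) :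
    pd g j x k = pd (fun y => g y k) j x := by
  rw [pd, pd, fderiv_apply hg k]
  rfl

theorem contDiffOn_pd {m : ℕ} {E : Type*} [NormedAddCommGroup E] [NormedSpace ℝ E]
    {g : (Fin m → ℝ) → E} {V : Set (Fin m → ℝ)} (hV : IsOpen V) (hg : ContDiffOn ℝ 2 g V)
    (j : Fin m) : ContDiffOn ℝ 1 (pd g j) V :=
  (hg.fderiv_of_isOpen hV (by norm_num)).clm_apply contDiffOn_const

theorem pd_pd_comm {m : ℕ} {E : Type*} [NormedAddCommGroup E] [NormedSpace ℝ E]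
    {g : (Fin m → ℝ) → E} {x : Fin m → ℝ} (hg : ContDiffAt ℝ 2 g x) (i j : Fin m) :
    pd (pd g i) j x = pd (pd g j) i x := by
  have hd : DifferentiableAt ℝ (fderiv ℝ g) x :=
    (hg.fderiv_right (m := 1) (by norm_num)).differentiableAt (by norm_num)
  have key : ∀ k l : Fin m, pd (pd g k) l x
      = fderiv ℝ (fderiv ℝ g) x (Pi.single l 1) (Pi.single k 1) := fun k l => by
    change fderiv ℝ (fun y => fderiv ℝ g y (Pi.single k 1)) x _ = _
    rw [fderiv_clm_apply hd (differentiableAt_const _)]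
    simp
  rw [key, key]
  exact (hg.isSymmSndFDerivAt (by simp)).eq _ _

theorem contDiffOn_sigmaCauchy {m : ℕ} {μ : ℝ} {p : (Fin m → ℝ) → ℝ}
    {v : (Fin m → ℝ) → Fin m → ℝ} {V : Set (Fin m → ℝ)} (hV : IsOpen V)
    (hv : ContDiffOn ℝ 2 v V) (hp : ContDiffOn ℝ 1 p V) (k i : Fin m) :
    ContDiffOn ℝ 1 (fun x => sigmaCauchy μ p v x k i) V := by
  have h₁ := contDiffOn_pi.1 (contDiffOn_pd hV hv i) k
  have h₂ := contDiffOn_pi.1 (contDiffOn_pd hV hv k) i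
  exact (hp.neg.mul contDiffOn_const).add (contDiffOn_const.mul (h₁.add h₂))

/-- The divergence of the Cauchy stress of an incompressible field. -/
theorem sum_pd_sigmaCauchy {m : ℕ} {μ : ℝ} {p : (Fin m → ℝ) → ℝ}
    {v : (Fin m → ℝ) → Fin m → ℝ} {V : Set (Fin m → ℝ)} (hV : IsOpen V)
    (hv : ContDiffOn ℝ 2 v V) (hp : ContDiffOn ℝ 1 p V)
    (hdiv : ∀ x ∈ V, ∑ j, pd v j x j = 0) {x : Fin m → ℝ} (hx : x ∈ V) (k : Fin m) :
    ∑ i, pd (fun y => sigmaCauchy μ p v y i k) i x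
      = -(pd p k x) + μ * ∑ j, pd (pd v j) j x k := by
  have hxV := hV.mem_nhds hx
  have hpx : DifferentiableAt ℝ p x := (hp.contDiffAt hxV).differentiableAt (by norm_num)
  have hd : ∀ j, DifferentiableAt ℝ (pd v j) x := fun j =>
    ((contDiffOn_pd hV hv j).contDiffAt hxV).differentiableAt (by norm_num)
  have hd' : ∀ j l, DifferentiableAt ℝ (fun y => pd v j y l) x := fun j =>
    differentiableAt_pi.1 (hd j)
  have hterm : ∀ i, pd (fun y => sigmaCauchy μ p v y i k) i x
      = -(if i = k then pd p i x else 0) + μ * (pd (pd v k) i x i + pd (pd v i) i x k) := by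
    intro i
    rw [pd_apply (hd k), pd_apply (hd i)]
    have h := (hpx.hasFDerivAt.neg.mul_const (if i = k then (1 : ℝ) else 0)).add
      (((hd' k i).hasFDerivAt.add (hd' i k).hasFDerivAt).const_mul μ)
    have h' : fderiv ℝ (fun y => sigmaCauchy μ p v y i k) x = _ := h.fderiv
    rw [pd, h']
    split_ifs <;> simp [pd, mul_add]
  have hmixed : ∑ i, pd (pd v k) i x i = 0 := by
    have h0 : pd (fun y => ∑ i, pd v i y i) k x = 0 := by
      have : (fun y => ∑ i, pd v i y i) =ᶠ[nhds x] fun _ => 0 :=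
        Filter.eventuallyEq_of_mem hxV hdiv
      rw [pd, this.fderiv_eq]
      simp
    rw [← h0, pd, fderiv_fun_sum fun i _ => hd' i i, sum_apply]
    refine Finset.sum_congr rfl fun i _ => ?_
    rw [pd_pd_comm (hv.contDiffAt hxV), pd_apply (hd i)]
    rfl
  simp only [hterm, Finset.sum_add_distrib, ← Finset.mul_sum, hmixed, zero_add,
    Finset.sum_neg_distrib, Finset.sum_ite_eq', Finset.mem_univ, if_true]

/-- The flux through planes normal to `e_i` of angular momentum about `x₀`: viscous and pressure
torque minus convective transport. -/
noncomputable def torqueFlux (ρ μ : ℝ) (x₀ : Fin 3 → ℝ) (p : (Fin 3 → ℝ) → ℝ)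
    (v : (Fin 3 → ℝ) → Fin 3 → ℝ) (i : Fin 3) (x : Fin 3 → ℝ) : Fin 3 → ℝ :=
  crossProduct (x - x₀) (fun k => sigmaCauchy μ p v x i k)
    - (v x i * ρ) • crossProduct (x - x₀) (v x)

theorem contDiffOn_torqueFlux {ρ μ : ℝ} {x₀ : Fin 3 → ℝ} {p : (Fin 3 → ℝ) → ℝ}
    {v : (Fin 3 → ℝ) → Fin 3 → ℝ} {V : Set (Fin 3 → ℝ)} (hV : IsOpen V)
    (hv : ContDiffOn ℝ 2 v V) (hp : ContDiffOn ℝ 1 p V) (i : Fin 3) :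
    ContDiffOn ℝ 1 (torqueFlux ρ μ x₀ p v i) V := by
  have hr : ContDiffOn ℝ 1 (fun x : Fin 3 → ℝ => x - x₀) V := by fun_prop
  have hσ : ContDiffOn ℝ 1 (fun x k => sigmaCauchy μ p v x i k) V :=
    contDiffOn_pi.2 fun k => contDiffOn_sigmaCauchy hV hv hp i k
  have hv1 : ContDiffOn ℝ 1 v V := hv.of_le (by norm_num)
  let L := (crossProduct (R := ℝ)).toContinuousBilinearMap
  exact ((L.contDiff.comp_contDiffOn hr).clm_apply hσ).sub
    (((contDiffOn_pi.1 hv1 i).mul contDiffOn_const).smul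
      ((L.contDiff.comp_contDiffOn hr).clm_apply hv1))

theorem pd_crossProduct_sub {g : (Fin 3 → ℝ) → Fin 3 → ℝ} {x₀ x : Fin 3 → ℝ}
    (hg : DifferentiableAt ℝ g x) (i : Fin 3) :
    pd (fun y => crossProduct (y - x₀) (g y)) i x
      = crossProduct (Pi.single i 1) (g x) + crossProduct (x - x₀) (pd g i x) := by
  let L := (crossProduct (R := ℝ)).toContinuousBilinearMap
  have h := L.hasFDerivAt_of_bilinear ((hasFDerivAt_id x).sub_const x₀) hg.hasFDerivAt
  have h' : fderiv ℝ (fun y => crossProduct (y - x₀) (g y)) x = _ := h.fderiv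
  rw [pd, h', add_comm]
  simp [L, pd]

/-- The divergence of the angular momentum flux of an incompressible field. -/
theorem sum_pd_torqueFlux {ρ μ : ℝ} {x₀ : Fin 3 → ℝ} {p : (Fin 3 → ℝ) → ℝ}
    {v : (Fin 3 → ℝ) → Fin 3 → ℝ} {V : Set (Fin 3 → ℝ)} (hV : IsOpen V)
    (hv : ContDiffOn ℝ 2 v V) (hp : ContDiffOn ℝ 1 p V)
    (hdiv : ∀ x ∈ V, ∑ j, pd v j x j = 0) {x : Fin 3 → ℝ} (hx : x ∈ V) :
    ∑ i, pd (torqueFlux ρ μ x₀ p v i) i x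
      = crossProduct (x - x₀) (fun k => -(pd p k x) + μ * (∑ j, pd (pd v j) j x k)
          - ρ * ∑ j, v x j * pd v j x k) := by
  have hxV := hV.mem_nhds hx
  have hvx : DifferentiableAt ℝ v x := (hv.contDiffAt hxV).differentiableAt (by norm_num)
  have hσ : ∀ i, DifferentiableAt ℝ (fun y k => sigmaCauchy μ p v y i k) x := fun i =>
    differentiableAt_pi.2 fun k =>
      ((contDiffOn_sigmaCauchy hV hv hp i k).contDiffAt hxV).differentiableAt (by norm_num)
  let L := (crossProduct (R := ℝ)).toContinuousBilinearMap
  have hcross : ∀ {g : (Fin 3 → ℝ) → Fin 3 → ℝ}, DifferentiableAt ℝ g x →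
      DifferentiableAt ℝ (fun y => crossProduct (y - x₀) (g y)) x := fun hg =>
    (L.hasFDerivAt_of_bilinear ((hasFDerivAt_id x).sub_const x₀)
      hg.hasFDerivAt).differentiableAt
  have hterm : ∀ i, pd (torqueFlux ρ μ x₀ p v i) i x
      = crossProduct (Pi.single i 1) (fun k => sigmaCauchy μ p v x i k)
        + crossProduct (x - x₀) (fun k => pd (fun y => sigmaCauchy μ p v y i k) i x)
        - ((pd v i x i * ρ) • crossProduct (x - x₀) (v x)
          + (v x i * ρ) • (crossProduct (Pi.single i 1) (v x)
            + crossProduct (x - x₀) (pd v i x))) := by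
    intro i
    have hvi := differentiableAt_pi.1 hvx i
    have h := (hcross (hσ i)).hasFDerivAt.sub
      ((hvi.hasFDerivAt.mul_const ρ).smul (hcross hvx).hasFDerivAt)
    have h' : fderiv ℝ (torqueFlux ρ μ x₀ p v i) x = _ := h.fderiv
    have hrow : (fun k => pd (fun y => sigmaCauchy μ p v y i k) i x)
        = pd (fun y k => sigmaCauchy μ p v y i k) i x := by
      ext k
      rw [pd_apply (hσ i)]
    rw [hrow, ← pd_crossProduct_sub (hσ i), ← pd_crossProduct_sub hvx, pd_apply hvx, pd, h']
    simp [pd, add_comm, mul_comm]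
  have hsig := sum_pd_sigmaCauchy (μ := μ) hV hv hp hdiv hx
  have hd := hdiv x hx
  simp only [hterm]
  simp only [← hsig]
  simp only [Fin.sum_univ_three] at hd ⊢
  ext k
  fin_cases k <;>
    simp [cross_apply, sigmaCauchy] <;>
    grind

/-- equivalence of Lagrange multiplier and control-volume torque evaluations
in `ℝ³`: if the spread Eulerian force density `f(x) = ∫_U F(s) φ(x − X(s)) ds` (kernel `φ`
of unit integral and vanishing first moment) vanishes outside the box
`B = Π_i [a_i, b_i] ⊆ ℝ³`, and the incompressible Navier–Stokes equations hold on `B` with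
the stated regularity on a neighborhood of `B`, then with `r(x) = x − x₀` and
`T = μ(∇u + ∇uᵀ)`, `∫_U (X(s) − x₀) × F(s) ds = ∫_B ρ r × ∂u/∂t dV
− ∮_{∂B} [ r × (n·(−pI + T)) − (n·u) ρ (r × u) ] dS` (face-wise sum with normals `±e_i`). -/
theorem lagrange_multiplier_eq_control_volume_torque
    (ρ μ : ℝ) (hρ : 0 < ρ) (hμ : 0 < μ)
    (a b : Fin 3 → ℝ) (hab : ∀ i, a i < b i)
    (x₀ : Fin 3 → ℝ) (t : ℝ)
    (φ : (Fin 3 → ℝ) → ℝ) (hφ : Integrable φ) (hφ1 : ∫ x, φ x = 1)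
    (hφm : Integrable (fun x : Fin 3 → ℝ => φ x • x))
    (hφm0 : ∫ x : Fin 3 → ℝ, φ x • x = 0)
    (U : Set (Fin 3 → ℝ)) (hU : MeasurableSet U)
    (F X : (Fin 3 → ℝ) → Fin 3 → ℝ)
    (hF : IntegrableOn F U) (hX : Measurable X)
    (hXF : IntegrableOn (fun s => ‖X s‖ * ‖F s‖) U)
    (f : (Fin 3 → ℝ) → Fin 3 → ℝ)
    (hfspread : ∀ x, f x = ∫ s in U, φ (x - X s) • F s)
    (hfsupp : ∀ x ∉ Set.Icc a b, f x = 0)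
    (V : Set (Fin 3 → ℝ)) (hV : IsOpen V) (hBV : Set.Icc a b ⊆ V)
    (u : ℝ → (Fin 3 → ℝ) → Fin 3 → ℝ)
    (ut : (Fin 3 → ℝ) → Fin 3 → ℝ)
    (p : (Fin 3 → ℝ) → ℝ)
    (hu2 : ContDiffOn ℝ 2 (u t) V)
    (hut : ∀ x ∈ V, HasDerivAt (fun τ => u τ x) (ut x) t)
    (hdiv : ∀ x ∈ V, ∑ j, pd (u t) j x j = 0)
    (hp : ContDiffOn ℝ 1 p V)
    (hf : ContinuousOn f V)
    (hNS : ∀ x ∈ Set.Icc a b, ∀ i,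
      ρ * (ut x i + ∑ j, u t x j * pd (u t) j x i)
        = -(pd p i x) + μ * (∑ j, pd (pd (u t) j) j x i) + f x i) :
    ∫ s in U, crossProduct (X s - x₀) (F s)
      = (∫ x in Set.Icc a b, ρ • crossProduct (x - x₀) (ut x))
        - ∑ i,
            (faceInt a b
                (fun x => crossProduct (x - x₀) (fun k => sigmaCauchy μ p (u t) x i k)
                  - (u t x i * ρ) • crossProduct (x - x₀) (u t x))
                i (b i)
              - faceInt a b
                  (fun x => crossProduct (x - x₀) (fun k => sigmaCauchy μ p (u t) x i k)
                    - (u t x i * ρ) • crossProduct (x - x₀) (u t x))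
                  i (a i)) := by
  let L := (crossProduct (R := ℝ)).toContinuousBilinearMap
  have hpt : ∀ x ∈ Set.Icc a b, ρ • crossProduct (x - x₀) (ut x)
      = crossProduct (x - x₀) (f x) + ∑ i, pd (torqueFlux ρ μ x₀ p (u t) i) i x := by
    intro x hx
    rw [sum_pd_torqueFlux hV hu2 hp hdiv (hBV hx), ← map_add, ← map_smul]
    congr 1
    ext k
    simp only [Pi.smul_apply, smul_eq_mul, Pi.add_apply]
    linear_combination hNS x hx k
  have hflux := contDiffOn_torqueFlux (ρ := ρ) (μ := μ) (x₀ := x₀) hV hu2 hp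
  have hdivInt : IntegrableOn (fun x => ∑ i, pd (torqueFlux ρ μ x₀ p (u t) i) i x)
      (Set.Icc a b) := by
    refine ContinuousOn.integrableOn_compact isCompact_Icc ?_
    refine continuousOn_finsetSum _ fun i _ => ?_
    exact (((hflux i).continuousOn_fderiv_of_isOpen hV le_rfl).clm_apply
      continuousOn_const).mono hBV
  have hcrossInt : IntegrableOn (fun x => crossProduct (x - x₀) (f x)) (Set.Icc a b) := by
    refine ContinuousOn.integrableOn_compact isCompact_Icc ?_
    have hr : ContinuousOn (fun x : Fin 3 → ℝ => x - x₀) (Set.Icc a b) := by fun_prop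
    exact ((L.continuous.comp_continuousOn hr).clm_apply (hf.mono hBV))
  have hgauss := integral_divergence_of_hasFDerivAt_off_countable' a b (fun i => (hab i).le)
    (torqueFlux ρ μ x₀ p (u t)) (fun i => fderiv ℝ (torqueFlux ρ μ x₀ p (u t) i)) ∅
    Set.countable_empty (fun i => (hflux i).continuousOn.mono hBV)
    (fun x hx i => (((hflux i).contDiffAt (hV.mem_nhds (hBV
      ⟨fun j => (hx.1 j trivial).1.le, fun j => (hx.1 j trivial).2.le⟩))).differentiableAt
        (by norm_num)).hasFDerivAt) hdivInt
  have hspread := integral_bilin_spread (volume.restrict U) volume L x₀ hφ hφ1 hφm hφm0 hF hX hXF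
  simp only [← hfspread] at hspread
  have hsupp : ∫ x in Set.Icc a b, L (x - x₀) (f x) = ∫ x, L (x - x₀) (f x) :=
    setIntegral_eq_integral_of_forall_compl_eq_zero fun x hx => by rw [hfsupp x hx, map_zero]
  rw [setIntegral_congr_fun measurableSet_Icc hpt, integral_add hcrossInt hdivInt]
  exact (hspread.symm.trans hsupp.symm).trans
    (eq_sub_of_add_eq (congrArg (_ + ·) hgauss.symm))
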